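/- For each i ≥ −1 and for all n ≥ 2i+4: (1) #C_i(n) > 0; (2) every element of C_i(n) has a plus-full-set, i.e. #N_i(n) = 0; (3) C_i(n) is the disjoint union of the sets F_i^j(n) over j ∈ [3i+4], and each F_i^j(n) is nonempty. -/

import Mathlib

/-!
Common definitions for formalizing "A recursion on maximal chains in the Tamari lattices"
(L. Nelson).

* Young diagrams are encoded by their row-length functions `lam : ℕ → ℕ` (rows indexed from 1,
  with `lam 0 = 0`).
* Dyck paths are lists of steps (north/east).
* Tableaux are encoded by entry functions `f : ℕ × ℕ → ℕ` (1-indexed boxes; value `0` means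
  "no box").  The label of box `(x, y)` is `f (x, y)`.
-/

noncomputable section

namespace TamariMaxChains

/-- A step of a lattice path: north or east. -/
inductive Step : Type
  | N : Step
  | E : Step
deriving DecidableEq

/-- Number of north steps of a path. -/
def nCount (p : List Step) : ℕ := p.count Step.N

/-- Number of east steps of a path. -/
def eCount (p : List Step) : ℕ := p.count Step.E

/-- `p` is a Dyck path: equally many norths and easts, and every prefix has at least as many
north steps as east steps (the path never goes below the diagonal `y = x`). -/
def IsDyck (p : List Step) : Prop :=
  nCount p = eCount p ∧ ∀ q : List Step, q <+: p → eCount q ≤ nCount q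

/-- `q` is a prime Dyck path: it meets the slope-one line joining its endpoints only at its
endpoints. -/
def IsPrimeDyck (q : List Step) : Prop :=
  q ≠ [] ∧ nCount q = eCount q ∧
    ∀ s : List Step, s <+: q → s ≠ [] → s ≠ q → eCount s < nCount s

/-- Covering relation of the Tamari lattice on Dyck paths:  `TamariCoverD P' P` means `P'`
covers `P`, i.e. `P'` is obtained from `P` by swapping an east step that is followed by a north
step with the prime Dyck subpath following it. -/
def TamariCoverD (P' P : List Step) : Prop :=
  ∃ a q b : List Step, IsPrimeDyck q ∧
    P = a ++ Step.E :: (q ++ b) ∧ P' = a ++ (q ++ Step.E :: b)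

/-- `lam` is the row-length function of a Young diagram: rows are indexed from `1`,
`lam x` is the number of boxes in row `x`, rows weakly decrease, finitely many boxes. -/
def IsDiagram (lam : ℕ → ℕ) : Prop :=
  lam 0 = 0 ∧ (∀ x, 1 ≤ x → lam (x + 1) ≤ lam x) ∧ ∃ N, ∀ x, N ≤ x → lam x = 0

/-- The height (number of north steps) of the prime path of row `d ≥ 1` of the Young diagram
with row lengths `lam`:  the least `t ≥ 1` such that either `t = d` (row `0` being regarded as
an infinite row of boxes) or row `d - t` has length at least `lam d + t`. -/
def primeHeight (lam : ℕ → ℕ) (d : ℕ) : ℕ :=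
  sInf {t | 1 ≤ t ∧ (t = d ∨ (t < d ∧ lam d + t ≤ lam (d - t)))}

/-- The last box of row `d` is a corner box (last box of its row and lowest box of
its column). -/
def IsCorner (lam : ℕ → ℕ) (d : ℕ) : Prop := 1 ≤ d ∧ 1 ≤ lam d ∧ lam (d + 1) < lam d

/-- The result of removing the `B`-strip of the last box `B` of row `d`: the last box of each of
the rows `d - h + 1, …, d` is removed, where `h` is the height of the prime path of row `d`. -/
def removeStrip (lam : ℕ → ℕ) (d : ℕ) : ℕ → ℕ := fun x =>
  if d + 1 ≤ x + primeHeight lam d ∧ x ≤ d then lam x - 1 else lam x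

/-- Covering relation of the Tamari lattice on Young diagrams:  `mu` covers `lam` iff `mu` is
obtained from `lam` by removing the `B`-strip of a corner box `B`. -/
def TamariCoverY (mu lam : ℕ → ℕ) : Prop := ∃ d, IsCorner lam d ∧ mu = removeStrip lam d

/-- The `B`-strip of the last box `B` of row `d`: the set of last boxes of rows
`d - h + 1, …, d`, where `h` is the height of the prime path of row `d`. -/
def stripSet (lam : ℕ → ℕ) (d : ℕ) : Set (ℕ × ℕ) :=
  {b | b.2 = lam b.1 ∧ 1 ≤ b.2 ∧ d + 1 ≤ b.1 + primeHeight lam d ∧ b.1 ≤ d}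

/-- The enclosure of the `B`-strip of the last box `B = (d, lam d)` of row `d`: all boxes
`(x, y)` with `d - h ≤ x ≤ d` and `lam d ≤ y ≤ lam d + h`, where row `0` is regarded as an
infinite row of boxes. -/
def enclosure (lam : ℕ → ℕ) (d : ℕ) : Set (ℕ × ℕ) :=
  {b | (b.1 = 0 ∨ b.2 ≤ lam b.1) ∧ 1 ≤ b.2 ∧
    d ≤ b.1 + primeHeight lam d ∧ b.1 ≤ d ∧ lam d ≤ b.2 ∧ b.2 ≤ lam d + primeHeight lam d}

/-- The Dyck path of length `2 n` corresponding to the Young diagram `lam` contained in the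
staircase `δ_{n-1}` (the Dyck path is the silhouette of the Young diagram). -/
def toDyck (n : ℕ) (lam : ℕ → ℕ) : List Step :=
  ((List.range n).flatMap fun k =>
    List.replicate (lam (n - k) - lam (n - k + 1)) Step.E ++ [Step.N]) ++
    List.replicate (n - lam 1) Step.E

/-- The prime path of row `d` of the Young diagram `lam`, as its list of steps (read from its
lower-left endpoint). -/
def primePathList (lam : ℕ → ℕ) (d : ℕ) : List Step :=
  Step.N :: ((((List.range (primeHeight lam d - 1)).flatMap fun j =>
    List.replicate (lam (d - 1 - j) - lam (d - j)) Step.E ++ [Step.N])) ++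
    List.replicate (lam d + primeHeight lam d - lam (d - (primeHeight lam d - 1))) Step.E)

/-- `S` translates to `S'` by `p` units down and `q` units to the right. -/
def TranslatesBy (p q : ℤ) (S S' : Set (ℕ × ℕ)) : Prop :=
  ∀ x y : ℕ, (x, y) ∈ S' ↔ ∃ a b : ℕ, (a, b) ∈ S ∧ (x : ℤ) = a + p ∧ (y : ℤ) = b + q

/-- `S` translates to `S'`. -/
def Translates (S S' : Set (ℕ × ℕ)) : Prop := ∃ p q : ℤ, TranslatesBy p q S S'

/-- The length of a tableau: its number of distinct labels (for an honest tableau, labels are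
exactly `1, …, tlen f`). -/
def tlen (f : ℕ × ℕ → ℕ) : ℕ := sSup {v | v ≠ 0 ∧ ∃ b, f b = v}

/-- The number of boxes in row `x` of a tableau. -/
def rowLen (f : ℕ × ℕ → ℕ) (x : ℕ) : ℕ := sSup {y | f (x, y) ≠ 0}

/-- The number of boxes in column `y` of a tableau. -/
def colLen (f : ℕ × ℕ → ℕ) (y : ℕ) : ℕ := sSup {x | f (x, y) ≠ 0}

/-- `f` is (the entry function of) a tableau: the support is a Young diagram (1-indexed),
rows strictly increase, columns weakly increase, and the set of labels is exactly
`{1, …, tlen f}`. -/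
def IsTableau (f : ℕ × ℕ → ℕ) : Prop :=
  (∀ y, f (0, y) = 0) ∧ (∀ x, f (x, 0) = 0) ∧
  {b : ℕ × ℕ | f b ≠ 0}.Finite ∧
  (∀ x y x' y', 1 ≤ x' → x' ≤ x → 1 ≤ y' → y' ≤ y → f (x, y) ≠ 0 → f (x', y') ≠ 0) ∧
  (∀ x y, f (x, y) ≠ 0 → f (x, y + 1) ≠ 0 → f (x, y) < f (x, y + 1)) ∧
  (∀ x y, f (x, y) ≠ 0 → f (x + 1, y) ≠ 0 → f (x, y) ≤ f (x + 1, y)) ∧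
  (∀ v, 1 ≤ v → (v ≤ tlen f ↔ ∃ b, f b = v))

/-- `T^(r)`: the subtableau of all entries at most `r`. -/
def trunc (f : ℕ × ℕ → ℕ) (r : ℕ) : ℕ × ℕ → ℕ := fun b => if f b ≤ r then f b else 0

/-- The shape (row-length function) of a tableau. -/
def shapeOf (f : ℕ × ℕ → ℕ) : ℕ → ℕ := fun x => rowLen f x

/-- The row index of the end-box of the `k`-set of `f` (the maximal row index of a box
labeled `k`). -/
def endRow (f : ℕ × ℕ → ℕ) (k : ℕ) : ℕ := sSup {x | ∃ y, f (x, y) = k}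

/-- `Y 0 ⋗ Y 1 ⋗ ⋯ ⋗ Y l` is a saturated chain in the Tamari order on Young diagrams whose
maximal element `Y 0` is the empty diagram (each `Y r` covers `Y (r+1)`). -/
def IsTamariChain (Y : ℕ → ℕ → ℕ) (l : ℕ) : Prop :=
  (∀ r, r ≤ l → IsDiagram (Y r)) ∧ (∀ x, Y 0 x = 0) ∧
    ∀ r, r < l → TamariCoverY (Y r) (Y (r + 1))

/-- The tableau `ψ(C)` of the saturated chain `C = (∅ = Y 0 ⋗ ⋯ ⋗ Y l)`: the boxes removed in
the transition `Y (r-1) ⋗ Y r` are labeled `r`; that is, each box of `Y l` is labeled by the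
least `r` such that the box belongs to `Y r`. -/
def psiFun (Y : ℕ → ℕ → ℕ) (l : ℕ) : ℕ × ℕ → ℕ := fun b =>
  if 1 ≤ b.1 ∧ 1 ≤ b.2 ∧ b.2 ≤ Y l b.1 then sInf {r | r ≤ l ∧ b.2 ≤ Y r b.1} else 0

/-- `f` is a `ψ`-tableau: it is in the image of `ψ`. -/
def IsPsiTab (f : ℕ × ℕ → ℕ) : Prop :=
  ∃ l Y, IsTamariChain Y l ∧ f = psiFun Y l

/-- Row lengths of the staircase shape `δ_{n-1} = (n-1, n-2, …, 1)`: row `x ≥ 1` has `n - x`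
boxes. -/
def dstair (n : ℕ) : ℕ → ℕ := fun x => if x = 0 then 0 else n - x

/-- `C_i(n)`, via `ψ`: the set of maximal chains of length `n + i` in the Tamari lattice `T_n`,
identified with the `ψ`-tableaux of length `n + i` and shape `δ_{n-1}`. -/
def MemC (i : ℤ) (n : ℕ) (f : ℕ × ℕ → ℕ) : Prop :=
  IsTableau f ∧ IsPsiTab f ∧ (∀ x, rowLen f x = dstair n x) ∧ (tlen f : ℤ) = (n : ℤ) + i

/-- The `r`-set of `f` (of shape `δ_{n-1}`) is a full-set with end-box `(k, n - k)`:
it begins in row `1` and ends in the outer diagonal, at the box `(k, n - k)`. -/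
def HasFullSetAt (f : ℕ × ℕ → ℕ) (n r k : ℕ) : Prop :=
  (∃ y, f (1, y) = r) ∧ 1 ≤ k ∧ k ≤ n - 1 ∧ f (k, n - k) = r ∧
    ∀ x y, f (x, y) = r → x ≤ k

/-- `f` has an `r`-full-set. -/
def HasFullSet (f : ℕ × ℕ → ℕ) (n r : ℕ) : Prop := ∃ k, HasFullSetAt f n r k

/-- `f` has an `r⁺`-full-set (plus-full-set): an `r`-full-set whose end-box `(k, n-k)` satisfies
`k = n - 1`, or `k ≤ n - 2` and the southwest neighbor has a smaller label. -/
def HasPlusFullSet (f : ℕ × ℕ → ℕ) (n r : ℕ) : Prop :=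
  ∃ k, HasFullSetAt f n r k ∧ (k = n - 1 ∨ (k ≤ n - 2 ∧ f (k + 1, n - k - 1) < r))

/-- `F_i^r(n)`: the set of `C ∈ C_i(n)` whose `r`-set is a plus-full-set and whose `j`-set is
not a plus-full-set for any `j ∈ [r-1]`. -/
def MemF (i : ℤ) (n : ℕ) (r : ℕ) (f : ℕ × ℕ → ℕ) : Prop :=
  MemC i n f ∧ HasPlusFullSet f n r ∧ ∀ j, 1 ≤ j → j < r → ¬ HasPlusFullSet f n j

/-- `N_i(n)`: the set of `C ∈ C_i(n)` having no plus-full-sets. -/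
def MemN (i : ℤ) (n : ℕ) (f : ℕ × ℕ → ℕ) : Prop :=
  MemC i n f ∧ ∀ r, ¬ HasPlusFullSet f n r

/-- `α_d`: shift all rows of index greater than `d` down one row and repeat row `d` in
row `d + 1`. -/
def alphaFun (d : ℕ) (f : ℕ × ℕ → ℕ) : ℕ × ℕ → ℕ := fun b =>
  if b.1 ≤ d then f b else f (b.1 - 1, b.2)

/-- `β_d`: append a box labeled `tlen f + 1` at the end of each of the rows `1, …, d`. -/
def betaFun (d : ℕ) (f : ℕ × ℕ → ℕ) : ℕ × ℕ → ℕ := fun b =>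
  if 1 ≤ b.1 ∧ b.1 ≤ d ∧ b.2 = rowLen f b.1 + 1 then tlen f + 1 else f b

/-- The number of boxes of row `x` of `f` whose label is at most `r` (these occupy an initial
segment of the row). -/
def lowLen (f : ℕ × ℕ → ℕ) (r x : ℕ) : ℕ := sSup {y | f (x, y) ≠ 0 ∧ f (x, y) ≤ r}

/-- The row index `d` used in the definition of `Ĉ(r)`: the minimal `k ∈ [n-1]` with
`C (k, n-k) ≤ r` if such `k` exists, and `n` otherwise. -/
def hatD (f : ℕ × ℕ → ℕ) (n r : ℕ) : ℕ :=
  sInf ({k | 1 ≤ k ∧ k ≤ n - 1 ∧ 1 ≤ f (k, n - k) ∧ f (k, n - k) ≤ r} ∪ {n})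

/-- `Ĉ(r)` for `C ∈ C_i(n)` and `0 ≤ r ≤ n + i`: starting from `β_d(α_d(C^(r)))` (where `d` is
as in `hatD`), the entries of `C` greater than `r` of row index less than `d` are translated one
unit to the right, those of row index greater than `d` are translated one unit down, and all
these labels are incremented by one. -/
def hatFun (f : ℕ × ℕ → ℕ) (n r : ℕ) : ℕ × ℕ → ℕ := fun b =>
  let d := hatD f n r
  let x := b.1
  let y := b.2
  if x = 0 ∨ y = 0 then 0
  else if x ≤ d then
    if f (x, y) ≠ 0 ∧ f (x, y) ≤ r then f (x, y)
    else if y = lowLen f r x + 1 then r + 1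
    else if r < f (x, y - 1) then f (x, y - 1) + 1
    else 0
  else if x = d + 1 then f (d, y)
  else if f (x - 1, y) = 0 then 0
  else if f (x - 1, y) ≤ r then f (x - 1, y)
  else f (x - 1, y) + 1

/-- `RepBy i m t r C0 C` : `C = (φ_{i,m+t-1}^{r 1} ∘ φ_{i,m+t-2}^{r 2} ∘ ⋯ ∘ φ_{i,m}^{r t}) C0`,
each factor being applied within its domain. -/
def RepBy (i : ℤ) (m t : ℕ) (r : ℕ → ℕ) (C0 C : ℕ × ℕ → ℕ) : Prop :=
  ∃ D : ℕ → ℕ × ℕ → ℕ, D 0 = C0 ∧ D t = C ∧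
    ∀ s, s < t →
      MemC i (m + s) (D s) ∧
      ((r (t - s) : ℤ) ≤ (m : ℤ) + s + i) ∧
      (∀ j, 1 ≤ j → j ≤ r (t - s) → ¬ HasPlusFullSet (D s) (m + s) j) ∧
      D (s + 1) = hatFun (D s) (m + s) (r (t - s))

/-- The set `𝕏_{d,n-1}^r` of Theorem 4.3: `ψ`-tableaux of length `r`, contained in `δ_{n-1}`,
whose row `d` has length `n - d` and whose prime path of row `d` has height `d`. -/
def MemX (d n r : ℕ) (f : ℕ × ℕ → ℕ) : Prop :=
  IsTableau f ∧ IsPsiTab f ∧ tlen f = r ∧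
    (∀ x, 1 ≤ x → rowLen f x ≤ n - x) ∧
    rowLen f d = n - d ∧
    primeHeight (shapeOf f) d = d

/-- The set `ℤ_{d,n}^{r+1}` of Theorem 4.3: `ψ`-tableaux of length `r + 1`, contained in `δ_n`,
such that rows `d` and `d+1` of the truncation at `r` are identical, the end-box of the
`(r+1)`-set is `(d, n-d+1)`, and the prime path of `(d, n-d+1)` has height `d`. -/
def MemZ (d n r : ℕ) (g : ℕ × ℕ → ℕ) : Prop :=
  IsTableau g ∧ IsPsiTab g ∧ tlen g = r + 1 ∧
    (∀ x, 1 ≤ x → rowLen g x ≤ n + 1 - x) ∧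
    (∀ y, trunc g r (d, y) = trunc g r (d + 1, y)) ∧
    g (d, n - d + 1) = r + 1 ∧ (∀ x y, g (x, y) = r + 1 → x ≤ d) ∧
    primeHeight (shapeOf g) d = d

lemma primeHeight_spec (lam : ℕ → ℕ) (d : ℕ) (hd : 1 ≤ d) :
    1 ≤ primeHeight lam d ∧ primeHeight lam d ≤ d ∧
    (∀ t, 1 ≤ t → t < primeHeight lam d → lam (d - t) < lam d + t) ∧
    (∀ t, 1 ≤ t → t < d → lam d + t ≤ lam (d - t) → primeHeight lam d ≤ t) := by
  have hmem : d ∈ {t | 1 ≤ t ∧ (t = d ∨ (t < d ∧ lam d + t ≤ lam (d - t)))} := ⟨hd, Or.inl rfl⟩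
  have h1 := Nat.sInf_mem ⟨d, hmem⟩
  have h2 := Nat.sInf_le hmem
  refine ⟨h1.1, h2, ?_, ?_⟩
  · intro t ht hlt
    by_contra hcon
    have := Nat.notMem_of_lt_sInf hlt
    apply this
    refine ⟨ht, Or.inr ⟨lt_of_lt_of_le hlt h2, by omega⟩⟩
  · intro t ht htd hle
    exact Nat.sInf_le ⟨ht, Or.inr ⟨htd, hle⟩⟩

lemma diagram_anti {lam : ℕ → ℕ} (h : IsDiagram lam) {x y : ℕ} (hx : 1 ≤ x) (hxy : x ≤ y) :
    lam y ≤ lam x := by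
  induction y, hxy using Nat.le_induction with
  | base => exact le_rfl
  | succ k hk ih => exact le_trans (h.2.1 k (by omega)) ih

/-- Data extracted from one covering step. -/
lemma cover_step {mu lam : ℕ → ℕ} (h : IsDiagram lam) (hc : TamariCoverY mu lam) :
    ∃ d k, 1 ≤ k ∧ k ≤ d ∧ 1 ≤ lam d ∧
      (∀ t, 1 ≤ t → t < k → lam (d - t) < lam d + t) ∧
      (2 ≤ d → lam d + 1 ≤ lam (d - 1) → k = 1) ∧
      (∀ x, d < x + k → x ≤ d → lam x = mu x + 1) ∧
      (∀ x, (d < x + k ∧ x ≤ d) ∨ lam x = mu x) := by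
  obtain ⟨d, ⟨hd, hl, hcor⟩, rfl⟩ := hc
  obtain ⟨h1, h2, h3, h4⟩ := primeHeight_spec lam d hd
  refine ⟨d, primeHeight lam d, h1, h2, hl, h3, ?_, ?_, ?_⟩
  · intro hd2 hle
    have := h4 1 le_rfl (by omega) hle
    omega
  · intro x hx hxd
    have hx1 : 1 ≤ x := by omega
    have := diagram_anti h hx1 hxd
    simp only [removeStrip]
    rw [if_pos ⟨by omega, hxd⟩]
    omega
  · intro x
    by_cases hx : d < x + primeHeight lam d ∧ x ≤ d
    · exact Or.inl hx
    · right
      simp only [removeStrip]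
      rw [if_neg]
      rintro ⟨h, h'⟩
      exact hx ⟨by omega, h'⟩

lemma chain_step {Y : ℕ → ℕ → ℕ} {l : ℕ} (hY : IsTamariChain Y l) {r : ℕ} (hr : r < l) (x : ℕ) :
    Y r x ≤ Y (r + 1) x ∧ Y (r + 1) x ≤ Y r x + 1 := by
  obtain ⟨d, k, -, -, -, -, -, h6, h7⟩ := cover_step (hY.1 (r + 1) hr) (hY.2.2 r hr)
  rcases h7 x with h | h
  · have := h6 x h.1 h.2
    omega
  · omega

lemma chain_mono {Y : ℕ → ℕ → ℕ} {l : ℕ} (hY : IsTamariChain Y l) {r s : ℕ} (hrs : r ≤ s)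
    (hs : s ≤ l) (x : ℕ) : Y r x ≤ Y s x := by
  induction s, hrs using Nat.le_induction with
  | base => exact le_rfl
  | succ k hk ih => exact le_trans (ih (by omega)) (chain_step hY (by omega) x).1

lemma psi_ne_iff {Y : ℕ → ℕ → ℕ} {l : ℕ} (hY : IsTamariChain Y l) (x y : ℕ) :
    psiFun Y l (x, y) ≠ 0 ↔ 1 ≤ x ∧ 1 ≤ y ∧ y ≤ Y l x := by
  simp only [psiFun]
  by_cases hc : 1 ≤ x ∧ 1 ≤ y ∧ y ≤ Y l x
  · rw [if_pos hc]
    refine ⟨fun _ => hc, fun _ => ?_⟩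
    have hm : sInf {r | r ≤ l ∧ y ≤ Y r x} ∈ {r | r ≤ l ∧ y ≤ Y r x} :=
      Nat.sInf_mem ⟨l, le_rfl, hc.2.2⟩
    intro h0
    rw [h0] at hm
    have := hm.2
    rw [hY.2.1] at this
    omega
  · rw [if_neg hc]
    simp [hc]

lemma psi_le_iff {Y : ℕ → ℕ → ℕ} {l : ℕ} (hY : IsTamariChain Y l) {x y s : ℕ} (hx : 1 ≤ x)
    (hy : 1 ≤ y) (hyl : y ≤ Y l x) (hs : s ≤ l) : psiFun Y l (x, y) ≤ s ↔ y ≤ Y s x := by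
  simp only [psiFun]
  rw [if_pos ⟨hx, hy, hyl⟩]
  have hm : sInf {r | r ≤ l ∧ y ≤ Y r x} ∈ {r | r ≤ l ∧ y ≤ Y r x} :=
    Nat.sInf_mem ⟨l, le_rfl, hyl⟩
  constructor
  · intro h
    exact le_trans hm.2 (chain_mono hY h hs x)
  · intro h
    exact Nat.sInf_le ⟨hs, h⟩

lemma psi_eq_iff {Y : ℕ → ℕ → ℕ} {l : ℕ} (hY : IsTamariChain Y l) {x y s : ℕ} (hs : 1 ≤ s) :
    psiFun Y l (x, y) = s ↔ 1 ≤ x ∧ s ≤ l ∧ y = Y s x ∧ Y s x = Y (s - 1) x + 1 := by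
  constructor
  · intro h
    have hne : psiFun Y l (x, y) ≠ 0 := by omega
    obtain ⟨hx, hy, hyl⟩ := (psi_ne_iff hY x y).1 hne
    have hl : psiFun Y l (x, y) ≤ l := (psi_le_iff hY hx hy hyl le_rfl).2 hyl
    have hsl : s ≤ l := by omega
    have h1 := (psi_le_iff hY hx hy hyl hsl).1 h.le
    have h2 : ¬ y ≤ Y (s - 1) x := fun h' => by
      have := (psi_le_iff hY hx hy hyl (s := s - 1) (by omega)).2 h'
      omega
    have h3 := chain_step hY (r := s - 1) (by omega) x
    rw [Nat.sub_add_cancel hs] at h3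
    exact ⟨hx, hsl, by omega, by omega⟩
  · rintro ⟨hx, hsl, rfl, h⟩
    have hyl := chain_mono hY hsl le_rfl x
    have h1 := (psi_le_iff hY hx (y := Y s x) (by omega) hyl hsl).2 le_rfl
    have h2 : ¬ psiFun Y l (x, Y s x) ≤ s - 1 := fun h' => by
      have := (psi_le_iff hY hx (y := Y s x) (by omega) hyl (s := s - 1) (by omega)).1 h'
      omega
    omega

lemma psi_exists {Y : ℕ → ℕ → ℕ} {l : ℕ} (hY : IsTamariChain Y l) {s : ℕ} (hs : 1 ≤ s)
    (hsl : s ≤ l) : ∃ b, psiFun Y l b = s := by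
  have hr : s - 1 < l := by omega
  obtain ⟨d, k, h1, h2, h3, -, -, h6, h7⟩ := cover_step (hY.1 (s - 1 + 1) hr) (hY.2.2 (s - 1) hr)
  rw [Nat.sub_add_cancel hs] at h6
  exact ⟨(d, Y s d), (psi_eq_iff hY hs).2 ⟨by omega, hsl, rfl, h6 d (by omega) le_rfl⟩⟩

lemma psi_le {Y : ℕ → ℕ → ℕ} {l : ℕ} (hY : IsTamariChain Y l) (b : ℕ × ℕ) :
    psiFun Y l b ≤ l := by
  rcases Nat.eq_zero_or_pos (psiFun Y l b) with h | h
  · omega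
  · exact ((psi_eq_iff hY (x := b.1) (y := b.2) h).1 rfl).2.1

lemma psi_tlen {Y : ℕ → ℕ → ℕ} {l : ℕ} (hY : IsTamariChain Y l) : tlen (psiFun Y l) = l := by
  have hb : ∀ v ∈ {v | v ≠ 0 ∧ ∃ b, psiFun Y l b = v}, v ≤ l := by
    rintro v ⟨-, b, rfl⟩
    exact psi_le hY b
  apply le_antisymm
  · exact csSup_le' hb
  · rcases Nat.eq_zero_or_pos l with h | h
    · omega
    · exact le_csSup ⟨l, hb⟩ ⟨by omega, psi_exists hY h le_rfl⟩

lemma psi_rowLen {Y : ℕ → ℕ → ℕ} {l : ℕ} (hY : IsTamariChain Y l) (x : ℕ) :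
    rowLen (psiFun Y l) x = Y l x := by
  have hb : ∀ v ∈ {y | psiFun Y l (x, y) ≠ 0}, v ≤ Y l x := by
    intro v hv
    exact ((psi_ne_iff hY x v).1 hv).2.2
  apply le_antisymm
  · exact csSup_le' hb
  · rcases Nat.eq_zero_or_pos (Y l x) with h | h
    · omega
    · refine le_csSup ⟨_, hb⟩ ((psi_ne_iff hY x _).2 ⟨?_, h, le_rfl⟩)
      by_contra hx
      have : x = 0 := by omega
      subst this
      have := (hY.1 l le_rfl).1
      omega

lemma psi_tableau {Y : ℕ → ℕ → ℕ} {l : ℕ} (hY : IsTamariChain Y l) : IsTableau (psiFun Y l) := by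
  have hD := hY.1 l le_rfl
  refine ⟨?_, ?_, ?_, ?_, ?_, ?_, ?_⟩
  · intro y
    by_contra h
    have := (psi_ne_iff hY _ _).1 h
    omega
  · intro y
    by_contra h
    have := (psi_ne_iff hY _ _).1 h
    omega
  · obtain ⟨N, hN⟩ := hD.2.2
    apply Set.Finite.subset (s := Set.Iic N ×ˢ Set.Iic (Y l 1))
      ((Set.finite_Iic _).prod (Set.finite_Iic _))
    rintro ⟨x, y⟩ h
    have h := (psi_ne_iff hY x y).1 h
    have h2 := diagram_anti hD le_rfl h.1
    refine ⟨?_, ?_⟩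
    · show x ≤ N
      by_contra hx
      have := hN x (by omega)
      omega
    · show y ≤ Y l 1
      omega
  · intro x y x' y' h1 h2 h3 h4 h
    have h := (psi_ne_iff hY x y).1 h
    have h5 := diagram_anti hD h1 h2
    exact (psi_ne_iff hY x' y').2 ⟨h1, h3, by omega⟩
  · intro x y h1 h2
    obtain ⟨-, -, e, e'⟩ := (psi_eq_iff hY (by omega)).1 (rfl : psiFun Y l (x, y + 1) = _)
    obtain ⟨a1, a2, a3⟩ := (psi_ne_iff hY x y).1 h1
    have := psi_le hY (x, y + 1)
    have := (psi_le_iff hY a1 a2 a3 (s := psiFun Y l (x, y + 1) - 1) (by omega)).2 (by omega)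
    omega
  · intro x y h1 h2
    obtain ⟨-, -, e, e'⟩ := (psi_eq_iff hY (by omega)).1 (rfl : psiFun Y l (x + 1, y) = _)
    obtain ⟨a1, a2, a3⟩ := (psi_ne_iff hY x y).1 h1
    have hle := psi_le hY (x + 1, y)
    have := (hY.1 _ hle).2.1 x a1
    exact (psi_le_iff hY a1 a2 a3 hle).2 (by omega)
  · intro v hv
    rw [psi_tlen hY]
    constructor
    · exact fun h => psi_exists hY hv h
    · rintro ⟨b, rfl⟩
      exact psi_le hY b

lemma memC_of_chain {Y : ℕ → ℕ → ℕ} {l n : ℕ} {i : ℤ} (hY : IsTamariChain Y l)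
    (hs : ∀ x, Y l x = dstair n x) (hl : (l : ℤ) = n + i) : MemC i n (psiFun Y l) :=
  ⟨psi_tableau hY, ⟨l, Y, hY, rfl⟩, fun x => by rw [psi_rowLen hY, hs], by rw [psi_tlen hY, hl]⟩

lemma chain_of_memC {n : ℕ} {i : ℤ} {f : ℕ × ℕ → ℕ} (h : MemC i n f) :
    ∃ l Y, IsTamariChain Y l ∧ f = psiFun Y l ∧ (∀ x, Y l x = dstair n x) ∧ (l : ℤ) = n + i := by
  obtain ⟨-, ⟨l, Y, hY, rfl⟩, h3, h4⟩ := h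
  refine ⟨l, Y, hY, rfl, fun x => ?_, ?_⟩
  · rw [← h3, psi_rowLen hY]
  · rw [← h4, psi_tlen hY]

lemma finite_memC (i : ℤ) (n : ℕ) : {C : ℕ × ℕ → ℕ | MemC i n C}.Finite := by
  let L := ((n : ℤ) + i).toNat + 1
  let g : (Fin (n + 1) × Fin (n + 1) → Fin L) → (ℕ × ℕ → ℕ) := fun u b =>
    if h : b.1 < n + 1 ∧ b.2 < n + 1 then (u (⟨b.1, h.1⟩, ⟨b.2, h.2⟩) : ℕ) else 0
  apply (Set.finite_range g).subset
  intro f hf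
  obtain ⟨l, Y, hY, rfl, h3, h4⟩ := chain_of_memC hf
  refine ⟨fun p => ⟨psiFun Y l (p.1, p.2), ?_⟩, ?_⟩
  · have := psi_le hY (p.1, p.2)
    simp only [L]
    omega
  · funext b
    obtain ⟨x, y⟩ := b
    simp only [g]
    split_ifs with hb
    · rfl
    · by_contra hne
      have := (psi_ne_iff hY x y).1 (Ne.symm hne)
      rw [h3, dstair] at this
      split_ifs at this <;> omega

/-- A label on the outer diagonal is the label of the end-box of its set. -/
lemma diag_end {Y : ℕ → ℕ → ℕ} {l n : ℕ} (hY : IsTamariChain Y l)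
    (hs : ∀ x, Y l x = dstair n x) {k x y s : ℕ} (hs1 : 1 ≤ s) (hk : 1 ≤ k) (hkn : k ≤ n)
    (h1 : psiFun Y l (k, n - k) = s) (h2 : psiFun Y l (x, y) = s) :
    x ≤ k ∧ (x = k ∨ x + y < n) := by
  obtain ⟨a1, a2, a3, a4⟩ := (psi_eq_iff hY hs1).1 h1
  obtain ⟨b1, b2, b3, b4⟩ := (psi_eq_iff hY hs1).1 h2
  have hr : s - 1 < l := by omega
  obtain ⟨d, m, c1, c2, c3, c4, -, c6, c7⟩ :=
    cover_step (hY.1 (s - 1 + 1) hr) (hY.2.2 (s - 1) hr)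
  rw [Nat.sub_add_cancel hs1] at c3 c4 c6 c7
  have hd : Y s d + d ≤ n := by
    have := chain_mono hY a2 le_rfl d
    rw [hs, dstair] at this
    split_ifs at this <;> omega
  have key : ∀ z, Y s z = Y (s - 1) z + 1 → z ≤ d ∧ (z = d ∨ z + Y s z < n) := by
    intro z hz
    rcases c7 z with h | h
    · refine ⟨h.2, ?_⟩
      rcases Nat.eq_or_lt_of_le h.2 with h' | h'
      · exact Or.inl h'
      · right
        have := c4 (d - z) (by omega) (by omega)
        rw [Nat.sub_sub_self h.2] at this
        omega
    · omega
  have e1 := key k a4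
  have e2 := key x b4
  omega

lemma diag_singleton {Y : ℕ → ℕ → ℕ} {l n : ℕ} (hY : IsTamariChain Y l)
    (hs : ∀ x, Y l x = dstair n x) {k s y : ℕ} (hk : 1 ≤ k) (hkn : k + 1 < n)
    (h1 : psiFun Y l (k + 1, n - (k + 1)) = s) (hle : psiFun Y l (k, n - k) < s)
    (h2 : psiFun Y l (1, y) = s) : False := by
  have hs1 : 1 ≤ s := by omega
  obtain ⟨a1, a2, a3, a4⟩ := (psi_eq_iff hY hs1).1 h1
  obtain ⟨b1, b2, b3, b4⟩ := (psi_eq_iff hY hs1).1 h2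
  have hr : s - 1 < l := by omega
  obtain ⟨d, m, c1, c2, c3, -, c5, c6, c7⟩ :=
    cover_step (hY.1 (s - 1 + 1) hr) (hY.2.2 (s - 1) hr)
  rw [Nat.sub_add_cancel hs1] at c3 c5 c6 c7
  have hd1 : d = k + 1 := by
    have := c6 d (by omega) le_rfl
    have e1 := diag_end hY hs hs1 (by omega) (by omega) h1
      ((psi_eq_iff hY hs1).2 ⟨by omega, a2, rfl, this⟩)
    rcases c7 (k + 1) with h | h <;> omega
  subst hd1
  have hk' : n - k ≤ Y s k := by
    refine (psi_le_iff hY hk (by omega) ?_ a2).1 hle.le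
    rw [hs, dstair]
    split_ifs <;> omega
  have hm := c5 (by omega) (by
    rw [Nat.add_sub_cancel]
    omega)
  rcases c7 1 with h | h <;> omega

/-- The key counting bound. -/
lemma count_bound {Y : ℕ → ℕ → ℕ} {l n m : ℕ} (hn : 1 ≤ n) (hY : IsTamariChain Y l)
    (hs : ∀ x, Y l x = dstair n x) (hl : l + 1 = n + m) (j : ℕ) (hj : j ≤ l)
    (hnp : ∀ s, 1 ≤ s → s ≤ j → ¬ HasPlusFullSet (psiFun Y l) n s) : j ≤ 3 * m := by
  classical
  set f := psiFun Y l with hf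
  have hpos : ∀ x y, 1 ≤ x → 1 ≤ y → x + y ≤ n → 1 ≤ f (x, y) := by
    intro x y hx hy hxy
    have : f (x, y) ≠ 0 := (psi_ne_iff hY x y).2 ⟨hx, hy, by
      rw [hs, dstair]; split_ifs <;> omega⟩
    omega
  have hlt : ∀ b, f b ≤ l := psi_le hY
  let A := (Finset.Icc 1 (n - 1)).image (fun y => f (1, y))
  let D := (Finset.Icc 1 (n - 1)).image (fun k => f (k, n - k))
  have hA : A.card = n - 1 := by
    rw [Finset.card_image_of_injOn]
    · simp
    · intro y hy y' hy' h
      simp only [Finset.coe_Icc, Set.mem_Icc] at hy hy'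
      have h : f (1, y) = f (1, y') := h
      have p := hpos 1 y (by omega) (by omega) (by omega)
      have e1 := ((psi_eq_iff hY p).1 (rfl : f (1, y) = _)).2.2.1
      have e2 := ((psi_eq_iff hY p).1 h.symm).2.2.1
      omega
  have hDinj : Set.InjOn (fun k => f (k, n - k)) (Finset.Icc 1 (n - 1) : Finset ℕ) := by
    intro y hy y' hy' h
    simp only [Finset.coe_Icc, Set.mem_Icc] at hy hy'
    have h : f (y, n - y) = f (y', n - y') := h
    have p := hpos y (n - y) (by omega) (by omega) (by omega)
    have e1 := diag_end hY hs p (by omega) (by omega) (rfl : f (y, n - y) = _) h.symm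
    omega
  have hD : D.card = n - 1 := by
    rw [Finset.card_image_of_injOn hDinj]
    simp
  have hAs : A ⊆ Finset.Icc 1 l := by
    intro s h
    obtain ⟨y, hy, rfl⟩ := Finset.mem_image.1 h
    rw [Finset.mem_Icc] at hy ⊢
    exact ⟨hpos _ _ (by omega) (by omega) (by omega), hlt _⟩
  have hDs : D ⊆ Finset.Icc 1 l := by
    intro s h
    obtain ⟨y, hy, rfl⟩ := Finset.mem_image.1 h
    rw [Finset.mem_Icc] at hy ⊢
    exact ⟨hpos _ _ (by omega) (by omega) (by omega), hlt _⟩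
  have hAc : (Finset.Icc 1 l \ A).card = m := by
    rw [Finset.card_sdiff_of_subset hAs, hA, Nat.card_Icc]
    omega
  have hDc : (Finset.Icc 1 l \ D).card = m := by
    rw [Finset.card_sdiff_of_subset hDs, hD, Nat.card_Icc]
    omega
  let K := (Finset.Icc 1 (n - 1)).filter (fun k => f (k, n - k) ≤ j ∧ f (k, n - k) ∈ A)
  have hK : ∀ k ∈ K, k + 1 < n ∧ f (k, n - k) < f (k + 1, n - (k + 1)) := by
    intro k hk
    obtain ⟨h1, h2, h3⟩ := Finset.mem_filter.1 hk
    rw [Finset.mem_Icc] at h1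
    have p := hpos k (n - k) (by omega) (by omega) (by omega)
    obtain ⟨y, hy, hyk⟩ := Finset.mem_image.1 h3
    have hfull : HasFullSetAt f n (f (k, n - k)) k := by
      refine ⟨⟨y, hyk⟩, h1.1, h1.2, rfl, ?_⟩
      intro x' y' h
      exact (diag_end hY hs p (by omega) (by omega) rfl h).1
    have hno := hnp _ p h2
    have hkn : k ≠ n - 1 := fun h => hno ⟨k, hfull, Or.inl h⟩
    have hge : ¬ f (k + 1, n - k - 1) < f (k, n - k) := fun h =>
      hno ⟨k, hfull, Or.inr ⟨by omega, h⟩⟩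
    refine ⟨by omega, ?_⟩
    rw [Nat.sub_sub] at hge
    refine lt_of_le_of_ne (not_lt.1 hge) ?_
    intro he
    have := hDinj (by simp; omega) (by simp; omega) he
    omega
  have hKc : K.card ≤ m := by
    rw [← hAc]
    apply Finset.card_le_card_of_injOn (fun k => f (k + 1, n - (k + 1)))
    · intro k hk
      have hk := Finset.mem_coe.1 hk
      obtain ⟨h1, h2⟩ := hK k hk
      obtain ⟨h3, -, -⟩ := Finset.mem_filter.1 hk
      rw [Finset.mem_Icc] at h3
      refine Finset.mem_coe.2 (Finset.mem_sdiff.2 ⟨Finset.mem_Icc.2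
        ⟨hpos _ _ (by omega) (by omega) (by omega), hlt _⟩, ?_⟩)
      intro hmem
      obtain ⟨y, hy, hyk⟩ := Finset.mem_image.1 hmem
      exact diag_singleton hY hs h3.1 h1 rfl h2 hyk
    · intro k hk k' hk' h
      have h1 := hK k (Finset.mem_coe.1 hk)
      have h2 := hK k' (Finset.mem_coe.1 hk')
      have := hDinj (by simp; omega) (by simp; omega) h
      omega
  have hsub : Finset.Icc 1 j ⊆ (Finset.Icc 1 l \ A) ∪ (Finset.Icc 1 l \ D) ∪
      K.image (fun k => f (k, n - k)) := by
    intro s hsj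
    rw [Finset.mem_Icc] at hsj
    have hsl : s ∈ Finset.Icc 1 l := Finset.mem_Icc.2 ⟨hsj.1, by omega⟩
    by_cases h1 : s ∈ A
    · by_cases h2 : s ∈ D
      · refine Finset.mem_union_right _ ?_
        obtain ⟨k, hk, rfl⟩ := Finset.mem_image.1 h2
        exact Finset.mem_image.2 ⟨k, Finset.mem_filter.2 ⟨hk, hsj.2, h1⟩, rfl⟩
      · exact Finset.mem_union_left _ (Finset.mem_union_right _ (Finset.mem_sdiff.2 ⟨hsl, h2⟩))
    · exact Finset.mem_union_left _ (Finset.mem_union_left _ (Finset.mem_sdiff.2 ⟨hsl, h1⟩))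
  have := Finset.card_le_card hsub
  have u1 := Finset.card_union_le ((Finset.Icc 1 l \ A) ∪ (Finset.Icc 1 l \ D))
    (K.image (fun k => f (k, n - k)))
  have u2 := Finset.card_union_le (Finset.Icc 1 l \ A) (Finset.Icc 1 l \ D)
  have u3 : (K.image (fun k => f (k, n - k))).card ≤ K.card := Finset.card_image_le
  rw [Nat.card_Icc] at this
  omega

lemma mk_cover {lam mu : ℕ → ℕ} (d h : ℕ) (h1 : 1 ≤ h) (h2 : h ≤ d) (h3 : 1 ≤ lam d)
    (h4 : lam (d + 1) < lam d) (h5 : ∀ t, 1 ≤ t → t < h → lam (d - t) < lam d + t)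
    (h6 : h = d ∨ lam d + h ≤ lam (d - h))
    (h7 : ∀ x, mu x = if d < x + h ∧ x ≤ d then lam x - 1 else lam x) : TamariCoverY mu lam := by
  obtain ⟨p1, p2, p3, p4⟩ := primeHeight_spec lam d (by omega)
  have hp : primeHeight lam d = h := by
    apply le_antisymm
    · rcases h6 with h6 | h6
      · omega
      · rcases Nat.eq_or_lt_of_le h2 with h' | h'
        · omega
        · exact p4 h h1 h' h6
    · by_contra hlt
      have hlt : primeHeight lam d < h := by omega
      have hm : primeHeight lam d ∈ {t | 1 ≤ t ∧ (t = d ∨ (t < d ∧ lam d + t ≤ lam (d - t)))} :=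
        Nat.sInf_mem ⟨d, by omega, Or.inl rfl⟩
      have := h5 _ p1 hlt
      rcases hm.2 with h | h <;> omega
  refine ⟨d, ⟨by omega, h3, h4⟩, ?_⟩
  funext x
  rw [h7 x]
  simp only [removeStrip, hp, Nat.succ_le_iff]

/-- The intermediate shapes: the first `C` columns of the staircase, with the outer diagonal boxes
of the defect columns of index greater than `D` missing.  The defect columns are
`1, 3, …, 2a-1, 2a+2, 2a+4, …, 2m`. -/
def Sh (n m a C D x : ℕ) : ℕ :=
  if x = 0 ∨ n ≤ x then 0
  else if n - x ≤ C ∧ 2 * D < n - x ∧ n - x ≤ 2 * m ∧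
      (((n - x) % 2 = 1 ∧ n - x < 2 * a) ∨ ((n - x) % 2 = 0 ∧ 2 * a < n - x)) then n - x - 1
  else min C (n - x)

lemma Sh_diagram (n m a C D : ℕ) : IsDiagram (Sh n m a C D) := by
  refine ⟨by simp [Sh], ?_, n, ?_⟩
  · intro x hx
    simp only [Sh]
    split_ifs <;> omega
  · intro x hx
    simp only [Sh]
    rw [if_pos (Or.inr hx)]

lemma Sh_col (n m a C D : ℕ) (hn : 2 * m + 2 ≤ n) (hC : C + 1 < n) :
    TamariCoverY (Sh n m a C D) (Sh n m a (C + 1) D) := by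
  by_cases hp : 2 * D < C + 1 ∧ C + 1 ≤ 2 * m ∧
      (((C + 1) % 2 = 1 ∧ C + 1 < 2 * a) ∨ ((C + 1) % 2 = 0 ∧ 2 * a < C + 1))
  · have hr : ∀ x, 1 ≤ x → x ≤ n - C - 2 → Sh n m a (C + 1) D x = C + 1 := by
      intro x h1 h2
      simp only [Sh]
      split_ifs <;> omega
    have hd := hr (n - C - 2) (by omega) le_rfl
    refine mk_cover (n - C - 2) (n - C - 2) (by omega) le_rfl (by omega) ?_ ?_ (Or.inl rfl) ?_
    · rw [hd]
      simp only [Sh]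
      split_ifs <;> omega
    · intro t h1 h2
      rw [hd, hr _ (by omega) (by omega)]
      omega
    · intro x
      simp only [Sh]
      split_ifs <;> omega
  · have hr : ∀ x, 1 ≤ x → x ≤ n - C - 1 → Sh n m a (C + 1) D x = C + 1 := by
      intro x h1 h2
      rcases Nat.eq_or_lt_of_le h2 with h3 | h3
      · have h4 : n - x = C + 1 := by omega
        simp only [Sh, h4]
        split_ifs <;> omega
      · simp only [Sh]
        split_ifs <;> omega
    have hd := hr (n - C - 1) (by omega) le_rfl
    refine mk_cover (n - C - 1) (n - C - 1) (by omega) le_rfl (by omega) ?_ ?_ (Or.inl rfl) ?_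
    · rw [hd]
      simp only [Sh]
      split_ifs <;> omega
    · intro t h1 h2
      rw [hd, hr _ (by omega) (by omega)]
      omega
    · intro x
      by_cases hx : 1 ≤ x ∧ x ≤ n - C - 1
      · rw [hr x hx.1 hx.2, if_pos (by omega)]
        simp only [Sh]
        split_ifs <;> omega
      · rw [if_neg (by omega)]
        simp only [Sh]
        split_ifs <;> omega

lemma Sh_def (n m a C D : ℕ) (hn : 2 * m + 2 ≤ n) (hC : C < n) (hD : D < m) (ha : a ≤ m)
    (hDC : (D < a ∧ 2 * D + 2 ≤ C) ∨ (a ≤ D ∧ 2 * D + 3 ≤ C)) :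
    TamariCoverY (Sh n m a C D) (Sh n m a C (D + 1)) := by
  obtain ⟨p, hp⟩ : ∃ p, (D < a ∧ p = 2 * D + 1) ∨ (a ≤ D ∧ p = 2 * D + 2) := by
    rcases Nat.lt_or_ge D a with h | h
    · exact ⟨_, Or.inl ⟨h, rfl⟩⟩
    · exact ⟨_, Or.inr ⟨h, rfl⟩⟩
  have hd : Sh n m a C (D + 1) (n - p) = p := by
    have : n - (n - p) = p := by omega
    simp only [Sh, this]
    split_ifs <;> omega
  have hd1 : Sh n m a C (D + 1) (n - p - 1) = p + 1 := by
    have : n - (n - p - 1) = p + 1 := by omega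
    simp only [Sh, this]
    split_ifs <;> omega
  refine mk_cover (n - p) 1 le_rfl (by omega) (by omega) ?_ ?_ (Or.inr (by omega)) ?_
  · rw [hd]
    simp only [Sh]
    split_ifs <;> omega
  · intro t h1 h2
    omega
  · intro x
    by_cases hx : x = n - p
    · subst hx
      rw [if_pos (by omega), hd]
      have : n - (n - p) = p := by omega
      simp only [Sh, this]
      split_ifs <;> omega
    · rw [if_neg (by omega)]
      simp only [Sh]
      split_ifs <;> omega

/-- The chain of shapes. -/
def Yc (n m a c s : ℕ) : ℕ → ℕ :=
  Sh n m a (min s (2 * a) + min (s - (2 * a + c)) (n - 1 - 2 * a))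
    (min (s - 2 * a) c + (s - (n - 1 + c)))

lemma Yc_eq {n m a c s C D : ℕ} (hC : min s (2 * a) + min (s - (2 * a + c)) (n - 1 - 2 * a) = C)
    (hD : min (s - 2 * a) c + (s - (n - 1 + c)) = D) : Yc n m a c s = Sh n m a C D := by
  rw [Yc, hC, hD]

lemma Yc_chain (n m a c : ℕ) (hn : 2 * m + 2 ≤ n) (ha : a ≤ m) (hc : c ≤ a) :
    IsTamariChain (Yc n m a c) (n - 1 + m) := by
  refine ⟨fun r _ => Sh_diagram _ _ _ _ _, ?_, ?_⟩
  · intro x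
    rw [Yc_eq (C := 0) (D := 0) (by omega) (by omega)]
    simp only [Sh]
    split_ifs <;> omega
  · intro s hs
    by_cases h1 : s < 2 * a
    · rw [Yc_eq (s := s) (C := s) (D := 0) (by omega) (by omega),
        Yc_eq (s := s + 1) (C := s + 1) (D := 0) (by omega) (by omega)]
      exact Sh_col _ _ _ _ _ hn (by omega)
    by_cases h2 : s < 2 * a + c
    · rw [Yc_eq (s := s) (C := 2 * a) (D := s - 2 * a) (by omega) (by omega),
        Yc_eq (s := s + 1) (C := 2 * a) (D := s - 2 * a + 1) (by omega) (by omega)]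
      exact Sh_def _ _ _ _ _ hn (by omega) (by omega) ha (by omega)
    by_cases h3 : s < n - 1 + c
    · rw [Yc_eq (s := s) (C := s - c) (D := c) (by omega) (by omega),
        Yc_eq (s := s + 1) (C := s - c + 1) (D := c) (by omega) (by omega)]
      exact Sh_col _ _ _ _ _ hn (by omega)
    · rw [Yc_eq (s := s) (C := n - 1) (D := s - (n - 1)) (by omega) (by omega),
        Yc_eq (s := s + 1) (C := n - 1) (D := s - (n - 1) + 1) (by omega) (by omega)]
      exact Sh_def _ _ _ _ _ hn (by omega) (by omega) ha (by omega)

lemma Yc_last (n m a c : ℕ) (hn : 2 * m + 2 ≤ n) (ha : a ≤ m) (hc : c ≤ a) (x : ℕ) :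
    Yc n m a c (n - 1 + m) x = dstair n x := by
  rw [Yc_eq (C := n - 1) (D := m) (by omega) (by omega)]
  simp only [Sh, dstair]
  split_ifs <;> omega

lemma Yc_memF (i : ℤ) (n m a c : ℕ) (hm : (m : ℤ) = i + 1) (hn : 2 * m + 2 ≤ n) (ha : a ≤ m)
    (hc : c ≤ a) : MemF i n (2 * a + c + 1) (psiFun (Yc n m a c) (n - 1 + m)) := by
  have hY := Yc_chain n m a c hn ha hc
  have e0 : Yc n m a c (2 * a + c) = Sh n m a (2 * a) c := Yc_eq (by omega) (by omega)
  have e1 : Yc n m a c (2 * a + c + 1) = Sh n m a (2 * a + 1) c := Yc_eq (by omega) (by omega)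
  refine ⟨memC_of_chain hY (Yc_last n m a c hn ha hc) (by omega), ?_, ?_⟩
  · refine ⟨n - (2 * a + 1), ⟨⟨2 * a + 1, ?_⟩, by omega, by omega, ?_, ?_⟩, ?_⟩
    · have r0 : ∀ x, x = 1 → Sh n m a (2 * a) c x = 2 * a := by
        intro x hx
        simp only [Sh]
        split_ifs <;> omega
      have r1 : ∀ x, x = 1 → Sh n m a (2 * a + 1) c x = 2 * a + 1 := by
        intro x hx
        simp only [Sh]
        split_ifs <;> omega
      rw [psi_eq_iff hY (by omega), Nat.add_sub_cancel, e0, e1, r0 1 rfl, r1 1 rfl]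
      omega
    · have : n - (n - (2 * a + 1)) = 2 * a + 1 := by omega
      rw [psi_eq_iff hY (by omega), Nat.add_sub_cancel, e0, e1]
      simp only [Sh, this]
      split_ifs <;> omega
    · intro x y h
      rw [psi_eq_iff hY (by omega), Nat.add_sub_cancel, e0, e1] at h
      obtain ⟨h1, -, -, h2⟩ := h
      by_contra hx
      simp only [Sh] at h2
      split_ifs at h2 <;> omega
    · by_cases h0 : a = 0
      · left
        omega
      · right
        refine ⟨by omega, ?_⟩
        have h3 : n - (n - (2 * a + 1)) - 1 = 2 * a := by omega
        have h4 : n - (2 * a + 1) + 1 = n - 2 * a := by omega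
        have h5 : n - (n - 2 * a) = 2 * a := by omega
        rw [h3, h4]
        have : psiFun (Yc n m a c) (n - 1 + m) (n - 2 * a, 2 * a) ≤ 2 * a := by
          rw [psi_le_iff hY (by omega) (by omega) _ (by omega)]
          · rw [Yc_eq (C := 2 * a) (D := 0) (by omega) (by omega)]
            simp only [Sh, h5]
            split_ifs <;> omega
          · rw [Yc_last n m a c hn ha hc, dstair]
            split_ifs <;> omega
        omega
  · rintro s hs1 hs2 ⟨k, ⟨⟨y, hy⟩, hk1, hk2, hk3, -⟩, hplus⟩
    rw [psi_eq_iff hY hs1] at hy hk3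
    by_cases h1 : s ≤ 2 * a
    · have e2 : Yc n m a c s = Sh n m a s 0 := Yc_eq (by omega) (by omega)
      have e3 : Yc n m a c (s - 1) = Sh n m a (s - 1) 0 := Yc_eq (by omega) (by omega)
      rw [e2, e3] at hk3
      obtain ⟨-, -, h2, h3⟩ := hk3
      have hks : n - k = s ∧ s % 2 = 0 := by
        simp only [Sh] at h2 h3
        split_ifs at h2 h3 <;> omega
      rcases hplus with hp | ⟨hp1, hp2⟩
      · omega
      · have h4 : k + 1 = n - (s - 1) := by omega
        have h5 : n - k - 1 = s - 1 := by omega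
        have h6 : n - (n - (s - 1)) = s - 1 := by omega
        rw [h4, h5] at hp2
        have hp3 : psiFun (Yc n m a c) (n - 1 + m) (n - (s - 1), s - 1) ≤ s - 1 := by omega
        rw [psi_le_iff hY (by omega) (by omega) _ (by omega), e3] at hp3
        · simp only [Sh, h6] at hp3
          split_ifs at hp3 <;> omega
        · rw [Yc_last n m a c hn ha hc, dstair]
          split_ifs <;> omega
    · have e2 : Yc n m a c s = Sh n m a (2 * a) (s - 2 * a) := Yc_eq (by omega) (by omega)
      have e3 : Yc n m a c (s - 1) = Sh n m a (2 * a) (s - 1 - 2 * a) :=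
        Yc_eq (by omega) (by omega)
      rw [e2, e3] at hy
      obtain ⟨-, -, -, h3⟩ := hy
      simp only [Sh] at h3
      split_ifs at h3 <;> omega

/-- A single column of height `n - 3`. -/
def Cv (n x : ℕ) : ℕ := if 1 ≤ x ∧ x + 3 ≤ n then 1 else 0

/-- Variant of the chain `Yc n m 0 0` whose first plus-full-set has label `2`. -/
def Yv (n m s : ℕ) : ℕ → ℕ :=
  if s = 1 then Cv n else Yc n m 0 0 s

lemma Yv_chain (n m : ℕ) (hn : 2 * m + 2 ≤ n) (hm : 1 ≤ m) :
    IsTamariChain (Yv n m) (n - 1 + m) := by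
  have hY := Yc_chain n m 0 0 hn (by omega) le_rfl
  refine ⟨?_, ?_, ?_⟩
  · intro r hr
    by_cases h : r = 1
    · rw [Yv, if_pos h]
      refine ⟨by simp [Cv], ?_, n, ?_⟩
      · intro x hx
        simp only [Cv]
        split_ifs <;> omega
      · intro x hx
        rw [Cv, if_neg (by omega)]
    · rw [Yv, if_neg h]
      exact hY.1 r hr
  · intro x
    rw [Yv, if_neg (by omega)]
    exact hY.2.1 x
  · intro s hs
    by_cases h0 : s = 0
    · subst h0
      have e : Yv n m (0 + 1) = Cv n := by rw [Yv, if_pos (by omega)]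
      rw [e]
      refine mk_cover (n - 3) (n - 3) (by omega) le_rfl ?_ ?_ ?_ (Or.inl rfl) ?_
      · simp only [Cv]
        split_ifs <;> omega
      · simp only [Cv]
        split_ifs <;> omega
      · intro t h1 h2
        simp only [Cv]
        split_ifs <;> omega
      · intro x
        have : Yv n m 0 x = 0 := by
          rw [Yv, if_neg (by omega)]
          exact hY.2.1 x
        rw [this]
        simp only [Cv]
        split_ifs <;> omega
    by_cases h1 : s = 1
    · subst h1
      have e : Yv n m (1 + 1) = Sh n m 0 2 0 := by
        rw [Yv, if_neg (by omega)]
        exact Yc_eq (by omega) (by omega)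
      have e' : Yv n m 1 = Cv n := by rw [Yv, if_pos rfl]
      rw [e, e']
      have hd : Sh n m 0 2 0 (n - 1) = 1 := by
        have : ∀ x, x = n - 1 → Sh n m 0 2 0 x = 1 := by
          intro x hx
          simp only [Sh]
          split_ifs <;> omega
        exact this _ rfl
      refine mk_cover (n - 1) (n - 1) (by omega) le_rfl (by omega) ?_ ?_ (Or.inl rfl) ?_
      · rw [hd]
        simp only [Sh]
        split_ifs <;> omega
      · intro t h1 h2
        rw [hd]
        simp only [Sh]
        split_ifs <;> omega
      · intro x
        simp only [Sh, Cv]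
        split_ifs <;> omega
    · have e1 : Yv n m s = Yc n m 0 0 s := by rw [Yv, if_neg h1]
      have e2 : Yv n m (s + 1) = Yc n m 0 0 (s + 1) := by rw [Yv, if_neg (by omega)]
      rw [e1, e2]
      exact hY.2.2 s hs

lemma Yv_memF (i : ℤ) (n m : ℕ) (hm : (m : ℤ) = i + 1) (hn : 2 * m + 2 ≤ n) (hm1 : 1 ≤ m) :
    MemF i n 2 (psiFun (Yv n m) (n - 1 + m)) := by
  have hY := Yv_chain n m hn hm1
  have e2 : Yv n m 2 = Sh n m 0 2 0 := by
    rw [Yv, if_neg (by omega)]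
    exact Yc_eq (by omega) (by omega)
  have e1 : Yv n m (2 - 1) = Cv n := by
    rw [Yv, if_pos (by omega)]
  refine ⟨memC_of_chain hY (fun x => ?_) (by omega), ?_, ?_⟩
  · rw [Yv, if_neg (by omega)]
    exact Yc_last n m 0 0 hn (by omega) le_rfl x
  · refine ⟨n - 1, ⟨⟨2, ?_⟩, by omega, by omega, ?_, ?_⟩, Or.inl rfl⟩
    · have r0 : Cv n 1 = 1 := by
        simp only [Cv]
        split_ifs <;> omega
      have r1 : ∀ x, x = 1 → Sh n m 0 2 0 x = 2 := by
        intro x hx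
        simp only [Sh]
        split_ifs <;> omega
      rw [psi_eq_iff hY (by omega), e2, e1, r0, r1 1 rfl]
      omega
    · have : n - (n - 1) = 1 := by omega
      have r0 : Cv n (n - 1) = 0 := by
        simp only [Cv]
        split_ifs <;> omega
      have r1 : ∀ x, x = n - 1 → Sh n m 0 2 0 x = 1 := by
        intro x hx
        simp only [Sh]
        split_ifs <;> omega
      rw [psi_eq_iff hY (by omega), e2, e1, r0, r1 _ rfl]
      omega
    · intro x y h
      rw [psi_eq_iff hY (by omega), e2, e1] at h
      obtain ⟨h1, -, -, h2⟩ := h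
      by_contra hx
      simp only [Sh] at h2
      split_ifs at h2 <;> omega
  · rintro s hs1 hs2 ⟨k, ⟨-, hk1, hk2, hk3, -⟩, -⟩
    have : s = 1 := by omega
    subst this
    rw [psi_eq_iff hY le_rfl] at hk3
    obtain ⟨-, -, h2, h3⟩ := hk3
    simp only [Yv, if_true, Cv] at h2
    split_ifs at h2 <;> omega

lemma memF_nonempty (i : ℤ) (n m j : ℕ) (hm : (m : ℤ) = i + 1) (hn : 2 * m + 2 ≤ n)
    (hj1 : 1 ≤ j) (hj : j ≤ 3 * m + 1) : {C : ℕ × ℕ → ℕ | MemF i n j C}.Nonempty := by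
  by_cases h2 : j = 2
  · subst h2
    exact ⟨_, Yv_memF i n m hm hn (by omega)⟩
  obtain ⟨a, c, ha, hc, he⟩ : ∃ a c, a ≤ m ∧ c ≤ a ∧ j = 2 * a + c + 1 := by
    by_cases h : j ≤ 2 * m + 1
    · exact ⟨(j - 1) / 2, (j - 1) % 2, by omega, by omega, by omega⟩
    · exact ⟨m, j - 1 - 2 * m, le_rfl, by omega, by omega⟩
  subst he
  exact ⟨_, Yc_memF i n m a c hm hn ha hc⟩

/-- **Theorem 5.7.**  For each `i ≥ -1` and all `n ≥ 2i + 4`:  (1) `#C_i(n) > 0`;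
(2) every element of `C_i(n)` has a plus-full-set, i.e. `#N_i(n) = 0`;  (3) `C_i(n)` is the
disjoint union of the sets `F_i^j(n)` over `j ∈ [3i+4]`, each of which is nonempty. -/
theorem chains_of_large_index (i : ℤ) (hi : -1 ≤ i) (n : ℕ) (hn : 2 * i + 4 ≤ (n : ℤ)) :
    0 < Set.ncard {C : ℕ × ℕ → ℕ | MemC i n C} ∧
    ((∀ C : ℕ × ℕ → ℕ, MemC i n C → ∃ j, HasPlusFullSet C n j) ∧
      Set.ncard {C : ℕ × ℕ → ℕ | MemN i n C} = 0) ∧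
    ({C : ℕ × ℕ → ℕ | MemC i n C} =
        ⋃ j ∈ Finset.Icc 1 (3 * i + 4).toNat, {C : ℕ × ℕ → ℕ | MemF i n j C}) ∧
    (∀ j k : ℕ, j ≠ k →
      Disjoint {C : ℕ × ℕ → ℕ | MemF i n j C} {C : ℕ × ℕ → ℕ | MemF i n k C}) ∧
    (∀ j ∈ Finset.Icc 1 (3 * i + 4).toNat, {C : ℕ × ℕ → ℕ | MemF i n j C}.Nonempty) := by
  obtain ⟨m, hm⟩ : ∃ m : ℕ, (m : ℤ) = i + 1 := ⟨(i + 1).toNat, by omega⟩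
  have hnm : 2 * m + 2 ≤ n := by omega
  have hj : (3 * i + 4).toNat = 3 * m + 1 := by omega
  rw [hj]
  have hne : ∀ j ∈ Finset.Icc 1 (3 * m + 1), {C : ℕ × ℕ → ℕ | MemF i n j C}.Nonempty := by
    intro j hj
    rw [Finset.mem_Icc] at hj
    exact memF_nonempty i n m j hm hnm hj.1 hj.2
  have hex : ∀ C : ℕ × ℕ → ℕ, MemC i n C →
      ∃ j, 1 ≤ j ∧ j ≤ 3 * m + 1 ∧ HasPlusFullSet C n j := by
    intro C hC
    obtain ⟨l, Y, hY, rfl, hs, hl⟩ := chain_of_memC hC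
    by_contra hcon
    have := count_bound (m := m) (by omega) hY hs (by omega) (3 * m + 1) (by omega)
      (fun s h1 h2 h3 => hcon ⟨s, h1, h2, h3⟩)
    omega
  refine ⟨?_, ⟨?_, ?_⟩, ?_, ?_, hne⟩
  · rw [Set.ncard_pos (finite_memC i n)]
    obtain ⟨C, hC⟩ := hne 1 (Finset.mem_Icc.2 ⟨le_rfl, by omega⟩)
    exact ⟨C, hC.1⟩
  · intro C hC
    obtain ⟨j, -, -, h⟩ := hex C hC
    exact ⟨j, h⟩
  · have : {C : ℕ × ℕ → ℕ | MemN i n C} = ∅ := by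
      ext C
      simp only [Set.mem_ofPred_eq, Set.mem_empty_iff_false, iff_false]
      rintro ⟨hC, hno⟩
      obtain ⟨j, -, -, h⟩ := hex C hC
      exact hno j h
    rw [this, Set.ncard_empty]
  · ext C
    simp only [Set.mem_ofPred_eq, Set.mem_iUnion, exists_prop]
    constructor
    · intro hC
      classical
      have h := hex C hC
      obtain ⟨h1, h2, h3⟩ := Nat.find_spec h
      refine ⟨Nat.find h, Finset.mem_Icc.2 ⟨h1, h2⟩, hC, h3, ?_⟩
      intro j hj1 hj2 hp
      exact Nat.find_min h hj2 ⟨hj1, by omega, hp⟩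
    · rintro ⟨j, -, hC⟩
      exact hC.1
  · have pos : ∀ (C : ℕ × ℕ → ℕ) j, MemF i n j C → 1 ≤ j := by
      intro C j hC
      obtain ⟨l, Y, hY, rfl, hs, hl⟩ := chain_of_memC hC.1
      obtain ⟨k, ⟨-, h1, h2, h3, -⟩, -⟩ := hC.2.1
      have : psiFun Y l (k, n - k) ≠ 0 := (psi_ne_iff hY _ _).2 ⟨h1, by omega, by
        rw [hs, dstair]
        split_ifs <;> omega⟩
      omega
    intro j k hjk
    rw [Set.disjoint_left]
    intro C hj hk
    have pj := pos C j hj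
    have pk := pos C k hk
    rcases Nat.lt_or_gt_of_ne hjk with h | h
    · exact hk.2.2 j pj h hj.2.1
    · exact hj.2.2 k pk h hk.2.1

end TamariMaxChains
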